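/- arXiv:2602.07875 — 3 statements merged into one kernel-verified Lean document; each statement's English description precedes it below -/
import Mathlib

section
/- Let μ be a nonzero finite Borel measure on ℝ^d with finite first moment, i.e. ∫ ‖y‖ dμ(y) < ∞. Fix x ∈ ℝ^d and let p be a point of the topological support of μ such that for every δ > 0 there exists η > 0 with ‖y − x‖ ≥ ‖p − x‖ + η for every y in the support of μ satisfying ‖y − p‖ ≥ δ (p is the unique nearest point of the support to x, with a strict distance gap outside every neighbourhood of p). For σ > 0 define the Gaussian-weighted mean F_σ(x) = (∫ y · exp(−‖y − x‖² / (2σ²)) dμ(y)) / (∫ exp(−‖y − x‖² / (2σ²)) dμ(y)). Then F_σ(x) → p as σ → 0⁺. -/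
open MeasureTheory Filter Metric

/-- The topological support of a Borel measure: points all of whose open
neighbourhoods (balls) have positive measure. -/
def measSupport {d : ℕ} (μ : Measure (EuclideanSpace ℝ (Fin d))) :
    Set (EuclideanSpace ℝ (Fin d)) :=
  {p | ∀ ε : ℝ, 0 < ε → 0 < μ (ball p ε)}

/-- **Theorem 3.1 (limiting behaviour of dirty estimates).**
If `p` is the unique nearest point of the support of `μ` to `x`, with a strict
distance gap outside every neighbourhood of `p`, then the Gaussian-weighted mean
`F_σ(x)` converges to `p` as `σ → 0⁺`. -/
theorem gaussian_weighted_mean_tendsto_nearest_point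
    {d : ℕ} (μ : Measure (EuclideanSpace ℝ (Fin d))) [IsFiniteMeasure μ]
    (hμ : μ ≠ 0)
    (hmom : Integrable (fun y => ‖y‖) μ)
    (x p : EuclideanSpace ℝ (Fin d))
    (hp : p ∈ measSupport μ)
    (hgap : ∀ δ : ℝ, 0 < δ → ∃ η : ℝ, 0 < η ∧
      ∀ y ∈ measSupport μ, δ ≤ ‖y - p‖ → ‖p - x‖ + η ≤ ‖y - x‖) :
    Tendsto
      (fun σ : ℝ =>
        (∫ y, Real.exp (-‖y - x‖ ^ 2 / (2 * σ ^ 2)) ∂μ)⁻¹ •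
          ∫ y, Real.exp (-‖y - x‖ ^ 2 / (2 * σ ^ 2)) • y ∂μ)
      (nhdsWithin 0 (Set.Ioi 0)) (nhds p) := by
  have hae : ∀ᵐ y ∂μ, y ∈ measSupport μ := by
    filter_upwards [Measure.support_mem_ae (μ := μ)] with y hy ε hε
    exact (Measure.mem_support_iff_forall y).1 hy _ (ball_mem_nhds y hε)
  have hid : Integrable (fun y : EuclideanSpace ℝ (Fin d) => y) μ :=
    (integrable_norm_iff (by fun_prop)).1 hmom
  have hyp : Integrable (fun y => y - p) μ := hid.sub (integrable_const p)
  rw [Metric.tendsto_nhds]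
  intro ε hε
  obtain ⟨η, hη, hg⟩ := hgap (ε / 2) (by positivity)
  set R := ‖p - x‖ with hR
  have hR0 : 0 ≤ R := norm_nonneg _
  set m := μ.real (ball p (η / 2)) with hm
  have hm0 : 0 < m := ENNReal.toReal_pos (hp _ (by positivity)).ne' (measure_ne_top _ _)
  set M := ∫ y, ‖y - p‖ ∂μ with hM
  have hM0 : 0 ≤ M := integral_nonneg fun _ => norm_nonneg _
  set c := (R + η) ^ 2 - (R + η / 2) ^ 2 with hc
  have hc0 : 0 < c := by rw [hc]; nlinarith
  have hlim : Tendsto (fun σ : ℝ => M / m * Real.exp (-(c * (2 * σ ^ 2)⁻¹)))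
      (nhdsWithin 0 (Set.Ioi 0)) (nhds 0) := by
    have h1 : Tendsto (fun σ : ℝ => 2 * σ ^ 2) (nhdsWithin 0 (Set.Ioi 0))
        (nhdsWithin 0 (Set.Ioi 0)) := by
      refine tendsto_nhdsWithin_iff.2 ⟨?_, ?_⟩
      · have : Tendsto (fun σ : ℝ => 2 * σ ^ 2) (nhds 0) (nhds (2 * 0 ^ 2)) :=
          (by fun_prop : Continuous fun σ : ℝ => 2 * σ ^ 2).tendsto 0
        simp only [ne_eq, OfNat.ofNat_ne_zero, not_false_eq_true, zero_pow, mul_zero] at this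
        exact this.mono_left nhdsWithin_le_nhds
      · filter_upwards [self_mem_nhdsWithin] with σ hσ
        have : (0 : ℝ) < σ := hσ
        show (0 : ℝ) < 2 * σ ^ 2
        positivity
    have h2 := Real.tendsto_exp_neg_atTop_nhds_zero.comp
      ((tendsto_inv_nhdsGT_zero.comp h1).const_mul_atTop hc0)
    simpa using h2.const_mul (M / m)
  filter_upwards [hlim.eventually (gt_mem_nhds (show (0 : ℝ) < ε / 2 by positivity)),
    self_mem_nhdsWithin] with σ hσ hσ0
  have hσ0 : (0 : ℝ) < σ := hσ0
  have hs : 0 < 2 * σ ^ 2 := by positivity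
  set w : EuclideanSpace ℝ (Fin d) → ℝ := fun y => Real.exp (-‖y - x‖ ^ 2 / (2 * σ ^ 2)) with hw
  have hwc : Continuous w := by rw [hw]; fun_prop
  have hw0 : ∀ y, 0 < w y := fun y => Real.exp_pos _
  have hw1 : ∀ y, ‖w y‖ ≤ 1 := fun y => by
    rw [Real.norm_of_nonneg (hw0 y).le]
    refine Real.exp_le_one_iff.2 (div_nonpos_of_nonpos_of_nonneg ?_ hs.le)
    have := sq_nonneg ‖y - x‖
    linarith
  have hwi : Integrable w μ := Integrable.of_bound hwc.aestronglyMeasurable 1 (ae_of_all _ hw1)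
  have hwy : Integrable (fun y => w y • y) μ :=
    hid.bdd_smul 1 hwc.aestronglyMeasurable (ae_of_all _ hw1)
  have hwp : Integrable (fun y => w y • (y - p)) μ :=
    hyp.bdd_smul 1 hwc.aestronglyMeasurable (ae_of_all _ hw1)
  set Z := ∫ y, w y ∂μ with hZ
  have hZm : Real.exp (-(R + η / 2) ^ 2 / (2 * σ ^ 2)) * m ≤ Z := by
    calc Real.exp (-(R + η / 2) ^ 2 / (2 * σ ^ 2)) * m
        = ∫ y in ball p (η / 2), Real.exp (-(R + η / 2) ^ 2 / (2 * σ ^ 2)) ∂μ := by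
          rw [setIntegral_const, smul_eq_mul, mul_comm]
      _ ≤ ∫ y in ball p (η / 2), w y ∂μ := by
          refine setIntegral_mono_on (integrable_const _).integrableOn hwi.integrableOn
            measurableSet_ball fun y hy => ?_
          refine Real.exp_le_exp.2 ?_
          have h1 : ‖y - x‖ ≤ R + η / 2 := by
            have h2 : ‖y - p‖ < η / 2 := by rwa [mem_ball, dist_eq_norm] at hy
            have h3 := norm_add_le (y - p) (p - x)
            rw [sub_add_sub_cancel] at h3
            linarith
          gcongr
      _ ≤ Z := setIntegral_le_integral hwi (ae_of_all _ fun y => (hw0 y).le)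
  have hZ0 : 0 < Z := lt_of_lt_of_le (by positivity) hZm
  set E := Real.exp (-(R + η) ^ 2 / (2 * σ ^ 2)) with hE
  have hEq : Z⁻¹ • (∫ y, w y • y ∂μ) - p = Z⁻¹ • ∫ y, w y • (y - p) ∂μ := by
    have : ∫ y, w y • (y - p) ∂μ = (∫ y, w y • y ∂μ) - Z • p := by
      simp_rw [smul_sub]
      rw [integral_sub hwy (hwi.smul_const p), integral_smul_const]
    rw [this, smul_sub, inv_smul_smul₀ hZ0.ne']
  have hN : ‖∫ y, w y • (y - p) ∂μ‖ ≤ ε / 2 * Z + E * M := by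
    calc ‖∫ y, w y • (y - p) ∂μ‖ ≤ ∫ y, (ε / 2 * w y + E * ‖y - p‖) ∂μ := by
          refine norm_integral_le_of_norm_le
            ((hwi.const_mul _).add (hyp.norm.const_mul _)) ?_
          filter_upwards [hae] with y hy
          rw [norm_smul, Real.norm_of_nonneg (hw0 y).le]
          have hE0 : 0 < E := Real.exp_pos _
          rcases lt_or_ge ‖y - p‖ (ε / 2) with h | h
          · have h1 := mul_le_mul_of_nonneg_left h.le (hw0 y).le
            have h2 := mul_nonneg hE0.le (norm_nonneg (y - p))
            linarith
          · have h1 := hg y hy h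
            have h2 : w y ≤ E := by
              refine Real.exp_le_exp.2 ?_
              gcongr
            have h3 := mul_le_mul_of_nonneg_right h2 (norm_nonneg (y - p))
            have h4 := mul_pos (half_pos hε) (hw0 y)
            linarith
      _ = ε / 2 * Z + E * M := by
          rw [integral_add (hwi.const_mul _) (hyp.norm.const_mul _), integral_const_mul,
            integral_const_mul]
  have hEM : E * M < ε / 2 * Z := by
    have hEe : E = Real.exp (-(c * (2 * σ ^ 2)⁻¹)) * Real.exp (-(R + η / 2) ^ 2 / (2 * σ ^ 2)) := by
      rw [hE, ← Real.exp_add]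
      congr 1
      rw [hc]
      ring
    calc E * M = (M / m * Real.exp (-(c * (2 * σ ^ 2)⁻¹))) *
          (Real.exp (-(R + η / 2) ^ 2 / (2 * σ ^ 2)) * m) := by
          rw [hEe]; field_simp
      _ < ε / 2 * (Real.exp (-(R + η / 2) ^ 2 / (2 * σ ^ 2)) * m) :=
          mul_lt_mul_of_pos_right hσ (by positivity)
      _ ≤ ε / 2 * Z := by gcongr
  rw [dist_eq_norm, hEq, norm_smul, norm_inv, Real.norm_of_nonneg hZ0.le,
    inv_mul_lt_iff₀ hZ0]
  linarith
end

section
/- Let μ be a finite Borel measure on ℝ^d, x ∈ ℝ^d, and A, B measurable sets. Suppose there exist radii 0 ≤ r₁ < r₂ such that μ({y ∈ B : ‖y − x‖ ≤ r₁}) > 0 and ‖y − x‖ ≥ r₂ for every y ∈ A. Then the ratio (∫_A exp(−‖y − x‖² / (2σ²)) dμ(y)) / (∫_B exp(−‖y − x‖² / (2σ²)) dμ(y)) tends to 0 as σ → 0⁺. -/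
open MeasureTheory Filter

/-- **Laplace-type concentration (far-mass negligibility).**
If `B` has positive mass within distance `r₁` of `x` and every point of `A` is at
distance at least `r₂ > r₁` from `x`, then the Gaussian-weighted mass of `A` is
negligible relative to that of `B` as the noise level `σ → 0⁺`. -/
theorem gaussian_far_mass_ratio_tendsto_zero
    {d : ℕ} (μ : Measure (EuclideanSpace ℝ (Fin d))) [IsFiniteMeasure μ]
    (x : EuclideanSpace ℝ (Fin d)) (A B : Set (EuclideanSpace ℝ (Fin d)))
    (hA : MeasurableSet A) (hB : MeasurableSet B)
    (r₁ r₂ : ℝ) (hr₁ : 0 ≤ r₁) (hr : r₁ < r₂)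
    (hBmass : 0 < μ {y ∈ B | ‖y - x‖ ≤ r₁})
    (hAfar : ∀ y ∈ A, r₂ ≤ ‖y - x‖) :
    Tendsto
      (fun σ : ℝ =>
        (∫ y in A, Real.exp (-‖y - x‖ ^ 2 / (2 * σ ^ 2)) ∂μ) /
          (∫ y in B, Real.exp (-‖y - x‖ ^ 2 / (2 * σ ^ 2)) ∂μ))
      (nhdsWithin 0 (Set.Ioi 0)) (nhds 0) := by
  have hint : ∀ σ : ℝ, Integrable (fun y => Real.exp (-‖y - x‖ ^ 2 / (2 * σ ^ 2))) μ := by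
    intro σ
    refine Integrable.of_bound (C := 1) (by fun_prop) (Eventually.of_forall fun y => ?_)
    rw [Real.norm_eq_abs, Real.abs_exp, Real.exp_le_one_iff]
    exact div_nonpos_of_nonpos_of_nonneg (by simp) (by positivity)
  set S : Set (EuclideanSpace ℝ (Fin d)) := {y ∈ B | ‖y - x‖ ≤ r₁} with hSdef
  have hS : MeasurableSet S :=
    hB.inter (measurableSet_le (f := fun y => ‖y - x‖) (g := fun _ => r₁) (by fun_prop)
      measurable_const)
  have hm : 0 < μ.real S := ENNReal.toReal_pos hBmass.ne' (measure_ne_top _ _)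
  have hnum : ∀ σ : ℝ, ∫ y in A, Real.exp (-‖y - x‖ ^ 2 / (2 * σ ^ 2)) ∂μ
      ≤ μ.real A * Real.exp (-r₂ ^ 2 / (2 * σ ^ 2)) := by
    intro σ
    have h := setIntegral_mono_on (μ := μ) (hint σ).integrableOn
      (integrable_const (Real.exp (-r₂ ^ 2 / (2 * σ ^ 2)))).integrableOn hA (fun y hy => by
        have h1 := hAfar y hy
        have h2 : r₂ ^ 2 ≤ ‖y - x‖ ^ 2 := pow_le_pow_left₀ (by linarith) h1 2
        exact Real.exp_le_exp.2 (div_le_div_of_nonneg_right (by linarith) (by positivity)))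
    simpa using h
  have hden : ∀ σ : ℝ, μ.real S * Real.exp (-r₁ ^ 2 / (2 * σ ^ 2)) ≤
      ∫ y in B, Real.exp (-‖y - x‖ ^ 2 / (2 * σ ^ 2)) ∂μ := by
    intro σ
    have h := setIntegral_mono_on (μ := μ)
      (integrable_const (Real.exp (-r₁ ^ 2 / (2 * σ ^ 2)))).integrableOn
      (hint σ).integrableOn hS (fun y hy => by
        have h2 : ‖y - x‖ ^ 2 ≤ r₁ ^ 2 := pow_le_pow_left₀ (norm_nonneg _) hy.2 2
        exact Real.exp_le_exp.2 (div_le_div_of_nonneg_right (by linarith) (by positivity)))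
    have h' : ∫ y in S, Real.exp (-‖y - x‖ ^ 2 / (2 * σ ^ 2)) ∂μ ≤
        ∫ y in B, Real.exp (-‖y - x‖ ^ 2 / (2 * σ ^ 2)) ∂μ :=
      setIntegral_mono_set (hint σ).integrableOn
        (Eventually.of_forall fun y => (Real.exp_pos _).le)
        (Eventually.of_forall fun y hy => hy.1)
    refine le_trans ?_ h'
    simpa using h
  have hc : 0 < (r₂ ^ 2 - r₁ ^ 2) / 2 := by nlinarith
  have hlim : Tendsto (fun σ : ℝ => μ.real A / μ.real S *
      Real.exp (-((r₂ ^ 2 - r₁ ^ 2) / 2 * (σ⁻¹) ^ 2))) (nhdsWithin 0 (Set.Ioi 0)) (nhds 0) := by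
    have h1 : Tendsto (fun σ : ℝ => (r₂ ^ 2 - r₁ ^ 2) / 2 * (σ⁻¹) ^ 2)
        (nhdsWithin 0 (Set.Ioi 0)) atTop :=
      ((tendsto_pow_atTop two_ne_zero).comp tendsto_inv_nhdsGT_zero).const_mul_atTop hc
    simpa using (Real.tendsto_exp_neg_atTop_nhds_zero.comp h1).const_mul (μ.real A / μ.real S)
  refine squeeze_zero (fun σ => ?_) (fun σ => ?_) hlim
  · exact div_nonneg (integral_nonneg fun y => (Real.exp_pos _).le)
      (integral_nonneg fun y => (Real.exp_pos _).le)
  · refine (div_le_div₀ (by positivity) (hnum σ) (by positivity) (hden σ)).trans (le_of_eq ?_)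
    rw [mul_div_mul_comm, ← Real.exp_sub]
    congr 2
    rw [← sub_div, div_eq_mul_inv, mul_inv, inv_pow]
    ring
end

section
/- Let μ be a finite Borel measure on ℝ^d with finite first moment, i.e. ∫ ‖y‖ dμ(y) < ∞, let x ∈ ℝ^d, and let A, B be measurable sets. Suppose there exist radii 0 ≤ r₁ < r₂ such that μ({y ∈ B : ‖y − x‖ ≤ r₁}) > 0 and ‖y − x‖ ≥ r₂ for every y ∈ A. Then the ratio (∫_A ‖y‖ · exp(−‖y − x‖² / (2σ²)) dμ(y)) / (∫_B exp(−‖y − x‖² / (2σ²)) dμ(y)) tends to 0 as σ → 0⁺. -/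
open MeasureTheory Filter

/-- **First-moment-weighted far-mass negligibility.**
Under a finite first moment, if `B` has positive mass within distance `r₁` of `x`
and every point of `A` is at distance at least `r₂ > r₁` from `x`, then the
`‖y‖`-weighted Gaussian mass of `A` is negligible relative to the Gaussian mass
of `B` as the noise level `σ → 0⁺`. -/
theorem gaussian_far_first_moment_ratio_tendsto_zero
    {d : ℕ} (μ : Measure (EuclideanSpace ℝ (Fin d))) [IsFiniteMeasure μ]
    (hmom : Integrable (fun y => ‖y‖) μ)
    (x : EuclideanSpace ℝ (Fin d)) (A B : Set (EuclideanSpace ℝ (Fin d)))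
    (hA : MeasurableSet A) (hB : MeasurableSet B)
    (r₁ r₂ : ℝ) (hr₁ : 0 ≤ r₁) (hr : r₁ < r₂)
    (hBmass : 0 < μ {y ∈ B | ‖y - x‖ ≤ r₁})
    (hAfar : ∀ y ∈ A, r₂ ≤ ‖y - x‖) :
    Tendsto
      (fun σ : ℝ =>
        (∫ y in A, ‖y‖ * Real.exp (-‖y - x‖ ^ 2 / (2 * σ ^ 2)) ∂μ) /
          (∫ y in B, Real.exp (-‖y - x‖ ^ 2 / (2 * σ ^ 2)) ∂μ))
      (nhdsWithin 0 (Set.Ioi 0)) (nhds 0) := by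
  set S : Set (EuclideanSpace ℝ (Fin d)) := {y ∈ B | ‖y - x‖ ≤ r₁} with hS
  have hSm : MeasurableSet S :=
    hB.inter (measurableSet_le (f := fun y => ‖y - x‖) (by fun_prop) measurable_const)
  have hm : 0 < μ.real S := ENNReal.toReal_pos hBmass.ne' (measure_ne_top μ S)
  set M : ℝ := ∫ y in A, ‖y‖ ∂μ with hM
  have hM0 : 0 ≤ M := integral_nonneg fun y => norm_nonneg y
  have hle1 : ∀ σ : ℝ, ∀ y : EuclideanSpace ℝ (Fin d),
      Real.exp (-‖y - x‖ ^ 2 / (2 * σ ^ 2)) ≤ 1 := by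
    intro σ y
    rw [Real.exp_le_one_iff, neg_div]
    have : 0 ≤ ‖y - x‖ ^ 2 / (2 * σ ^ 2) := by positivity
    linarith
  have hmeas : ∀ σ : ℝ, Measurable (fun y : EuclideanSpace ℝ (Fin d) =>
      Real.exp (-‖y - x‖ ^ 2 / (2 * σ ^ 2))) := by
    intro σ
    fun_prop
  have hint : ∀ σ : ℝ, Integrable (fun y : EuclideanSpace ℝ (Fin d) =>
      Real.exp (-‖y - x‖ ^ 2 / (2 * σ ^ 2))) μ := by
    intro σ
    refine Integrable.of_bound (hmeas σ).aestronglyMeasurable 1 (ae_of_all _ fun y => ?_)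
    rw [Real.norm_eq_abs, abs_of_pos (Real.exp_pos _)]
    exact hle1 σ y
  have hnum : ∀ σ : ℝ, (∫ y in A, ‖y‖ * Real.exp (-‖y - x‖ ^ 2 / (2 * σ ^ 2)) ∂μ)
      ≤ M * Real.exp (-r₂ ^ 2 / (2 * σ ^ 2)) := by
    intro σ
    rw [hM, ← integral_mul_const]
    refine setIntegral_mono_on ?_ ((hmom.mul_const _).integrableOn) hA ?_
    · refine Integrable.integrableOn ?_
      refine hmom.mono (by
        exact (measurable_norm.mul (hmeas σ)).aestronglyMeasurable) (ae_of_all _ fun y => ?_)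
      rw [norm_mul, Real.norm_eq_abs (Real.exp _), abs_of_pos (Real.exp_pos _)]
      exact mul_le_of_le_one_right (norm_nonneg _) (hle1 σ y)
    · intro y hy
      have h2 := hAfar y hy
      have h0 : 0 ≤ r₂ := hr₁.trans hr.le
      gcongr
  have hden : ∀ σ : ℝ, μ.real S * Real.exp (-r₁ ^ 2 / (2 * σ ^ 2))
      ≤ ∫ y in B, Real.exp (-‖y - x‖ ^ 2 / (2 * σ ^ 2)) ∂μ := by
    intro σ
    have h1 : μ.real S * Real.exp (-r₁ ^ 2 / (2 * σ ^ 2))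
        = ∫ y in S, Real.exp (-r₁ ^ 2 / (2 * σ ^ 2)) ∂μ := by
      rw [setIntegral_const, smul_eq_mul]
    rw [h1]
    refine (setIntegral_mono_on (integrable_const _).integrableOn (hint σ).integrableOn hSm
      ?_).trans (setIntegral_mono_set (hint σ).integrableOn
        (ae_of_all _ fun y => (Real.exp_pos _).le) ?_)
    · intro y hy
      have h2 : ‖y - x‖ ≤ r₁ := hy.2
      gcongr
    · exact HasSubset.Subset.eventuallyLE (fun y hy => hy.1)
  have hlim : Tendsto (fun σ : ℝ => M / μ.real S *
      Real.exp (-((r₂ ^ 2 - r₁ ^ 2) / 2 * (σ⁻¹) ^ 2)))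
      (nhdsWithin 0 (Set.Ioi 0)) (nhds 0) := by
    have hc : 0 < (r₂ ^ 2 - r₁ ^ 2) / 2 := by nlinarith
    have h1 : Tendsto (fun σ : ℝ => (r₂ ^ 2 - r₁ ^ 2) / 2 * (σ⁻¹) ^ 2)
        (nhdsWithin 0 (Set.Ioi 0)) atTop :=
      ((tendsto_pow_atTop two_ne_zero).comp tendsto_inv_nhdsGT_zero).const_mul_atTop hc
    simpa using (Real.tendsto_exp_neg_atTop_nhds_zero.comp h1).const_mul (M / μ.real S)
  refine squeeze_zero (fun σ => ?_) (fun σ => ?_) hlim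
  · exact div_nonneg (integral_nonneg fun y => by positivity)
      (integral_nonneg fun y => by positivity)
  · refine (div_le_div₀ (by positivity) (hnum σ) (by positivity) (hden σ)).trans (le_of_eq ?_)
    rw [mul_div_mul_comm, ← Real.exp_sub]
    congr 2
    rw [← sub_div, div_eq_mul_inv, mul_inv, inv_pow]
    ring
end
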